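/- For any integers n and s with 1 ≤ s ≤ n-1, the maximum number of edges of an L_s-free graph on n vertices equals max{ C(s,2), C(n,2) - C(n-⌊(s-1)/2⌋, 2) + c }, where c = 0 if s is odd and c = 1 if s is even, and C(a,2) = a(a-1)/2 denotes a binomial coefficient. -/

import Mathlib

open SimpleGraph Matrix

/-- The adjacency matrix of a simple graph, over `ℝ`. -/
noncomputable def adjMat {V : Type*} (G : SimpleGraph V) : Matrix V V ℝ :=
  fun a b => by classical exact if G.Adj a b then 1 else 0

/-- The spectral radius of a graph: the largest (real) eigenvalue of its adjacency
matrix, expressed as the supremum of the real spectrum. -/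
noncomputable def specRad {V : Type*} [Fintype V] [DecidableEq V] (G : SimpleGraph V) : ℝ :=
  sSup (spectrum ℝ (adjMat G))

/-- A linear forest: an acyclic graph in which every vertex has degree at most 2,
i.e. every connected component is a path. -/
def IsLinearForest {V : Type*} (H : SimpleGraph V) : Prop :=
  H.IsAcyclic ∧ ∀ v, {w | H.Adj v w}.ncard ≤ 2

/-- `G` contains some member of `𝓛 s`, the family of linear forests with `s` edges. -/
def ContainsLinForest {V : Type*} (G : SimpleGraph V) (s : ℕ) : Prop :=
  ∃ H : SimpleGraph V, H ≤ G ∧ IsLinearForest H ∧ H.edgeSet.ncard = s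

/-- `G` belongs to `Ex_sp(n, {K_{k+1}, 𝓛_s})`: it is `{K_{k+1}, 𝓛_s}`-free and has the
maximum spectral radius among all such graphs on `n` vertices. -/
def IsExtremal (n k s : ℕ) (G : SimpleGraph (Fin n)) : Prop :=
  G.CliqueFree (k + 1) ∧ ¬ ContainsLinForest G s ∧
    ∀ H : SimpleGraph (Fin n), H.CliqueFree (k + 1) → ¬ ContainsLinForest H s →
      specRad H ≤ specRad G

/-- The degree of `v` in `G`. -/
noncomputable def degOf {V : Type*} (G : SimpleGraph V) (v : V) : ℕ :=
  {w | G.Adj v w}.ncard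


/-- Sum of a weight over consecutive pairs of a list. -/
def pairSum {V : Type*} (w : V → V → ℕ) : List V → ℕ
  | [] => 0
  | [_] => 0
  | a :: b :: l => w a b + pairSum w (b :: l)

theorem pairSum_split {V : Type*} (w : V → V → ℕ) (A : List V) (a b : V) (B : List V) :
    pairSum w (A ++ a :: b :: B) = pairSum w (A ++ [a]) + w a b + pairSum w (b :: B) := by
  induction A with
  | nil => simp [pairSum]
  | cons x A ih =>
    cases A with
    | nil => simp [pairSum]; omega
    | cons y A =>
      simp only [List.cons_append, pairSum] at ih ⊢
      omega

theorem pairSum_mono {V : Type*} (w w' : V → V → ℕ) (l : List V)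
    (h : ∀ A x y B, l = A ++ x :: y :: B → w x y ≤ w' x y) : pairSum w l ≤ pairSum w' l := by
  induction l with
  | nil => simp [pairSum]
  | cons a l ih =>
    cases l with
    | nil => simp [pairSum]
    | cons b l =>
      simp only [pairSum]
      have h1 := h [] a b l rfl
      have h2 := ih (fun A x y B hl => h (a :: A) x y B (by rw [hl]; rfl))
      omega

theorem pairSum_reverse {V : Type*} (w : V → V → ℕ) (hw : ∀ x y, w x y = w y x) (l : List V) :
    pairSum w l.reverse = pairSum w l := by
  induction l with
  | nil => simp [pairSum]
  | cons a l ih =>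
    cases l with
    | nil => simp [pairSum]
    | cons b l =>
      have := pairSum_split w l.reverse b a []
      simp only [List.reverse_cons, List.append_assoc, List.cons_append, List.nil_append] at this ih ⊢
      rw [this, ih]
      simp [pairSum, hw a b]
      omega

/-- Two weights: sum of `f` over first coordinates and `g` over the second ones. -/
theorem pairSum_add {V : Type*} (f g : V → ℕ) (a : V) (l : List V) (z : V) :
    pairSum (fun x y => f x + g y) (a :: l ++ [z]) + f z + g a =
      ((a :: l ++ [z]).map f).sum + ((a :: l ++ [z]).map g).sum := by
  induction l generalizing a with
  | nil => simp [pairSum]; omega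
  | cons b l ih =>
    have := ih b
    simp only [List.cons_append, pairSum, List.map_cons, List.sum_cons] at this ⊢
    omega

open Classical in
/-- Adjacency indicator. -/
noncomputable def adjW {V : Type*} (G : SimpleGraph V) (x y : V) : ℕ := if G.Adj x y then 1 else 0

theorem adjW_comm {V : Type*} (G : SimpleGraph V) (x y : V) : adjW G x y = adjW G y x := by
  by_cases h : G.Adj x y
  · simp [adjW, h, h.symm]
  · have h' : ¬ G.Adj y x := fun hh => h hh.symm
    simp [adjW, h, h']

theorem adjW_le {V : Type*} (G : SimpleGraph V) (x y : V) : adjW G x y ≤ 1 := by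
  unfold adjW; split <;> simp

theorem linForest_of_list {V : Type*} [Finite V] (G : SimpleGraph V) (l : List V) (hl : l.Nodup) (k : ℕ)
    (hk : k ≤ pairSum (adjW G) l) :
    ∃ H : SimpleGraph V, H ≤ G ∧ IsLinearForest H ∧ H.edgeSet.ncard = k ∧
      (∀ x y, H.Adj x y → x ∈ l) ∧ (∀ a ∈ l.head?, {w | H.Adj a w}.ncard ≤ 1) := by
  have hbot : ∃ H : SimpleGraph V, H ≤ G ∧ IsLinearForest H ∧ H.edgeSet.ncard = 0 ∧
      (∀ x y, H.Adj x y → x ∈ l) ∧ (∀ a ∈ l.head?, {w | H.Adj a w}.ncard ≤ 1) :=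
    ⟨⊥, bot_le, ⟨by simp, by simp⟩, by simp, by simp, by simp⟩
  induction l generalizing k with
  | nil =>
    simp only [pairSum, Nat.le_zero] at hk
    subst hk; exact hbot
  | cons a l ih =>
    cases l with
    | nil =>
      simp only [pairSum, Nat.le_zero] at hk
      subst hk; exact hbot
    | cons b l =>
      have ih := fun k hk => ih (List.nodup_cons.1 hl).2 k hk
        ⟨⊥, bot_le, ⟨by simp, by simp⟩, by simp, by simp, by simp⟩
      have ha := (List.nodup_cons.1 hl).1
      by_cases h : k ≤ pairSum (adjW G) (b :: l)
      · obtain ⟨H, h1, h2, h3, h4, h5⟩ := ih k h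
        refine ⟨H, h1, h2, h3, fun x y hxy => List.mem_cons_of_mem _ (h4 x y hxy), ?_⟩
        intro c hc
        simp at hc
        subst hc
        have : {w | H.Adj a w} = ∅ := by
          ext w; simp; intro hw; exact ha (h4 _ _ hw)
        simp [this]
      · obtain ⟨H, h1, h2, h3, h4, h5⟩ := ih _ le_rfl
        simp only [pairSum] at hk
        have hw := adjW_le G a b
        have hab : G.Adj a b := by
          by_contra hc
          simp [adjW, hc] at hk; omega
        have hkk : k = pairSum (adjW G) (b :: l) + 1 := by omega
        have hiso : ∀ w, ¬ H.Adj a w := fun w hw => ha (h4 _ _ hw)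
        have hiso' : ∀ w, ¬ H.Adj w a := fun w hw => ha (h4 _ _ hw.symm)
        have hne : a ≠ b := hab.ne
        have hNa : {w | (H ⊔ edge a b).Adj a w} ⊆ {b} := by
          intro w; simp [edge_adj, hiso]; tauto
        have hNb : {w | (H ⊔ edge a b).Adj b w} ⊆ insert a {w | H.Adj b w} := by
          intro w; simp [edge_adj]; tauto
        have hN : ∀ x, x ≠ a → x ≠ b → {w | (H ⊔ edge a b).Adj x w} ⊆ {w | H.Adj x w} := by
          intro x hx hx' w; simp [edge_adj, hx, hx']
        have hA : {w | (H ⊔ edge a b).Adj a w}.ncard ≤ 1 := by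
          simpa using Set.ncard_le_ncard hNa
        refine ⟨H ⊔ edge a b, ?_, ⟨?_, ?_⟩, ?_, ?_, ?_⟩
        · refine sup_le h1 ?_
          intro x y; simp only [edge_adj]
          rintro ⟨⟨rfl, rfl⟩ | ⟨rfl, rfl⟩, _⟩
          · exact hab
          · exact hab.symm
        · refine IsAcyclic.sup_edge_of_not_reachable ?_ h2.1
          rintro ⟨p⟩
          cases p with
          | nil => exact hne rfl
          | cons h _ => exact hiso _ h
        · intro x
          by_cases hxa : x = a
          · subst hxa; omega
          by_cases hxb : x = b
          · subst hxb
            have := Set.ncard_le_ncard hNb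
            have := Set.ncard_insert_le a {w | H.Adj x w}
            have := h5 x (by simp)
            omega
          · exact (Set.ncard_le_ncard (hN x hxa hxb)).trans (h2.2 x)
        · rw [edgeSet_sup, edgeSet_edge_of_ne hne, Set.union_singleton,
            Set.ncard_insert_of_notMem (by simpa using hiso b), h3, hkk]
        · intro x y
          simp only [sup_adj, edge_adj]
          rintro (h | ⟨⟨rfl, rfl⟩ | ⟨rfl, rfl⟩, _⟩)
          · exact List.mem_cons_of_mem _ (h4 _ _ h)
          · simp
          · simp
        · intro c hc
          simp at hc
          subst hc
          exact hA

/-- `G` has a full vertex ordering with at least `s` adjacent consecutive pairs. -/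
def HasOrd {V : Type*} (G : SimpleGraph V) (s : ℕ) : Prop :=
  ∃ l : List V, l.Nodup ∧ (∀ v, v ∈ l) ∧ s ≤ pairSum (adjW G) l

theorem contains_of_hasOrd {V : Type*} [Finite V] (G : SimpleGraph V) (s : ℕ) (h : HasOrd G s) :
    ContainsLinForest G s := by
  obtain ⟨l, h1, _, h3⟩ := h
  obtain ⟨H, a, b, c, _⟩ := linForest_of_list G l h1 s h3
  exact ⟨H, a, b, c⟩

theorem sum_adjW {V : Type*} [Finite V] (G : SimpleGraph V) (u : V) (l : List V) (h1 : l.Nodup)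
    (h2 : ∀ v, v ∈ l) : (l.map (adjW G u)).sum = {w | G.Adj u w}.ncard := by
  classical
  have := Fintype.ofFinite V
  rw [← List.sum_toFinset _ h1]
  have : l.toFinset = Finset.univ := by ext; simp [h2]
  rw [this, Set.ncard_eq_toFinset_card']
  trans ∑ x, if G.Adj u x then 1 else 0
  · rfl
  · simp

/-- The 2-opt argument. -/
theorem deg_sum_le_aux {V : Type*} [Finite V] (G : SimpleGraph V) (u v : V)
    (hn : ¬ G.Adj u v) (A B : List V) (h1 : (A ++ u :: v :: B).Nodup)
    (h2 : ∀ x, x ∈ A ++ u :: v :: B)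
    (h : ¬ HasOrd G (pairSum (adjW G) (A ++ u :: v :: B) + 1)) :
    {w | G.Adj u w}.ncard + {w | G.Adj v w}.ncard ≤ pairSum (adjW G) (A ++ u :: v :: B) := by
  have hc := adjW_comm G
  have key : ∀ l' : List V, l'.Perm (A ++ u :: v :: B) →
      pairSum (adjW G) l' ≤ pairSum (adjW G) (A ++ u :: v :: B) := by
    intro l' hp
    by_contra hlt
    exact h ⟨l', hp.nodup_iff.2 h1, fun x => hp.mem_iff.2 (h2 x), by omega⟩
  have huv : adjW G u v = 0 := by simp [adjW, hn]
  have hvu : adjW G v u = 0 := by rw [hc, huv]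
  have huu : adjW G u u = 0 := by simp [adjW]
  have hvv : adjW G v v = 0 := by simp [adjW]
  have hS := pairSum_split (adjW G) A u v B
  -- pairwise inequality
  have hpair : pairSum (fun x y => adjW G u x + adjW G v y) (A ++ u :: v :: B) ≤
      pairSum (adjW G) (A ++ u :: v :: B) := by
    apply pairSum_mono
    intro C x y D hCD
    have hl := hCD
    rw [List.append_eq_append_iff] at hCD
    rcases hCD with ⟨as, rfl, hD⟩ | ⟨bs, rfl, hD⟩
    · -- the pair (x,y) is at or to the right of u
      cases as with
      | nil =>
        simp at hD
        obtain ⟨rfl, rfl, _⟩ := hD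
        simp [huu, hvv]
      | cons a as =>
        simp at hD
        obtain ⟨rfl, hD⟩ := hD
        -- v :: B = as ++ x :: y :: D
        have hp := key (A ++ u :: (as ++ [x]).reverse ++ y :: D) (by
          rw [hD]; simp only [List.append_assoc, List.cons_append]
          refine List.Perm.append_left _ (List.Perm.cons _ ?_)
          have := (List.reverse_perm (as ++ [x])).append_right (y :: D)
          simpa using this)
        have e1 : pairSum (adjW G) (v :: B) =
            pairSum (adjW G) (as ++ [x]) + adjW G x y + pairSum (adjW G) (y :: D) := by
          rw [hD]; exact pairSum_split _ _ _ _ _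
        obtain ⟨as', has⟩ : ∃ as', as ++ [x] = v :: as' := by
          cases as with
          | nil => simp at hD ⊢; exact hD.1.symm
          | cons z as => simp at hD ⊢; exact hD.1.symm
        have e2 : pairSum (adjW G) (A ++ u :: (as ++ [x]).reverse ++ y :: D) =
            pairSum (adjW G) (A ++ [u]) + adjW G u x + pairSum (adjW G) (as ++ [x]) + adjW G v y
              + pairSum (adjW G) (y :: D) := by
          have r : A ++ u :: (as ++ [x]).reverse ++ y :: D
             = A ++ u :: x :: (as.reverse ++ y :: D) := by simp
          rw [r, pairSum_split]
          have r2 : x :: (as.reverse ++ y :: D) = as'.reverse ++ v :: y :: D := by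
            have : x :: as.reverse = as'.reverse ++ [v] := by
              have := congrArg List.reverse has
              simpa using this
            rw [← List.cons_append, this]; simp
          rw [r2, pairSum_split]
          have r3 : as'.reverse ++ [v] = (as ++ [x]).reverse := by rw [has]; simp
          rw [r3, pairSum_reverse _ hc]; omega
        omega
    · cases bs with
      | nil =>
        simp at hD
        obtain ⟨rfl, rfl, _⟩ := hD
        simp [huu, hvv]
      | cons b bs =>
        simp only [List.cons_append, List.cons.injEq] at hD
        obtain ⟨rfl, hD⟩ := hD
        -- y :: D = bs ++ u :: v :: B, A = C ++ x :: bs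
        obtain ⟨bs', hbs⟩ : ∃ bs', bs ++ [u] = y :: bs' := by
          cases bs with
          | nil => simp at hD ⊢; exact hD.1.symm
          | cons z bs => simp at hD ⊢; exact hD.1.symm
        have hp := key (C ++ x :: (bs ++ [u]).reverse ++ v :: B) (by
          simp only [List.append_assoc, List.cons_append]
          refine List.Perm.append_left _ (List.Perm.cons _ ?_)
          have := (List.reverse_perm (bs ++ [u])).append_right (v :: B)
          simpa using this)
        have e1 : pairSum (adjW G) ((C ++ x :: bs) ++ [u]) =
            pairSum (adjW G) (C ++ [x]) + adjW G x y + pairSum (adjW G) (bs ++ [u]) := by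
          have r : (C ++ x :: bs) ++ [u] = C ++ x :: y :: bs' := by
            simp [← hbs]
          rw [r, pairSum_split, hbs]
        have e2 : pairSum (adjW G) (C ++ x :: (bs ++ [u]).reverse ++ v :: B) =
            pairSum (adjW G) (C ++ [x]) + adjW G x u + pairSum (adjW G) (bs ++ [u]) + adjW G y v
              + pairSum (adjW G) (v :: B) := by
          have r : C ++ x :: (bs ++ [u]).reverse ++ v :: B
             = C ++ x :: u :: (bs.reverse ++ v :: B) := by simp
          rw [r, pairSum_split]
          have r2 : u :: (bs.reverse ++ v :: B) = bs'.reverse ++ y :: v :: B := by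
            have : u :: bs.reverse = bs'.reverse ++ [y] := by
              have := congrArg List.reverse hbs
              simpa using this
            rw [← List.cons_append, this]; simp
          rw [r2, pairSum_split]
          have r3 : bs'.reverse ++ [y] = (bs ++ [u]).reverse := by rw [hbs]; simp
          rw [r3, pairSum_reverse _ hc]; omega
        rw [hc x u, hc y v] at e2
        omega
  rw [← sum_adjW G u _ h1 h2, ← sum_adjW G v _ h1 h2]
  -- ends
  obtain ⟨a, A', hA⟩ : ∃ a A', A ++ [u] = a :: A' := by
    cases A <;> simp
  obtain ⟨B', z, hB⟩ : ∃ B' z, v :: B = B' ++ [z] :=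
    ⟨(v :: B).dropLast, (v :: B).getLast (by simp), (List.dropLast_append_getLast _).symm⟩
  have hva : adjW G v a = 0 := by
    have hp := key ((A ++ [u]).reverse ++ v :: B) (by
      have := (List.reverse_perm (A ++ [u])).append_right (v :: B)
      simpa using this)
    have r : (A ++ [u]).reverse ++ v :: B = A'.reverse ++ a :: v :: B := by rw [hA]; simp
    have r3 : A'.reverse ++ [a] = (A ++ [u]).reverse := by rw [hA]; simp
    rw [r, pairSum_split, r3, pairSum_reverse _ hc, hc a v] at hp
    omega
  have huz : adjW G u z = 0 := by
    have hp := key (A ++ u :: (v :: B).reverse) (by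
      exact List.Perm.append_left _ (List.Perm.cons _ (List.reverse_perm _)))
    have r : A ++ u :: (v :: B).reverse = A ++ u :: z :: B'.reverse := by rw [hB]; simp
    have r3 : z :: B'.reverse = (v :: B).reverse := by rw [hB]; simp
    rw [r, pairSum_split, r3, pairSum_reverse _ hc] at hp
    omega
  have hL : A ++ u :: v :: B = a :: (A' ++ B') ++ [z] := by
    have : A ++ u :: v :: B = (A ++ [u]) ++ (v :: B) := by simp
    rw [this, hA, hB]; simp
  have := pairSum_add (adjW G u) (adjW G v) a (A' ++ B') z
  rw [← hL] at this
  omega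

theorem deg_sum_le {V : Type*} [Finite V] (G : SimpleGraph V) (s : ℕ) (u v : V) (huv : u ≠ v)
    (hn : ¬ G.Adj u v) (hG : ¬ HasOrd G s) (hGe : HasOrd (G ⊔ edge u v) s) :
    {w | G.Adj u w}.ncard + {w | G.Adj v w}.ncard + 1 ≤ s := by
  obtain ⟨l, h1, h2, h3⟩ := hGe
  have hmono : ∀ l' : List V, (∀ A x y B, l' = A ++ x :: y :: B →
      ¬ (x = u ∧ y = v) ∧ ¬ (x = v ∧ y = u)) →
      pairSum (adjW (G ⊔ edge u v)) l' ≤ pairSum (adjW G) l' := by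
    intro l' hl'
    apply pairSum_mono
    intro A x y B hl
    have := hl' A x y B hl
    by_cases hx : (G ⊔ edge u v).Adj x y
    · have hx' : G.Adj x y := by
        simp only [sup_adj, edge_adj] at hx
        tauto
      simp [adjW, hx, hx']
    · simp [adjW, hx]
  have main : ∀ u' v' A B, (u' = u ∧ v' = v ∨ u' = v ∧ v' = u) → l = A ++ u' :: v' :: B →
      {w | G.Adj u' w}.ncard + {w | G.Adj v' w}.ncard + 1 ≤ s := by
    intro u' v' A B huv' hl
    subst hl
    have hn' : ¬ G.Adj u' v' := by
      rcases huv' with ⟨rfl, rfl⟩ | ⟨rfl, rfl⟩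
      · exact hn
      · exact fun h => hn h.symm
    have hnd := h1
    rw [List.nodup_append] at hnd
    obtain ⟨n1, n2, n3⟩ := hnd
    simp only [List.nodup_cons, List.mem_cons, not_or] at n2
    have a1 := hmono (A ++ [u']) (by
      intro C x y D hl
      have hx : x ∈ A ++ [u'] := by rw [hl]; simp
      have hy : y ∈ A ++ [u'] := by rw [hl]; simp
      have hv' : v' ∉ A ++ [u'] := by
        intro h
        simp at h
        rcases h with h | h
        · exact n3 _ h v' (by simp) rfl
        · exact n2.1.1 h.symm
      grind)
    have a2 := hmono (v' :: B) (by
      intro C x y D hl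
      have hx : x ∈ v' :: B := by rw [hl]; simp
      have hy : y ∈ v' :: B := by rw [hl]; simp
      have hv' : u' ∉ v' :: B := by
        intro h
        simp at h
        rcases h with h | h
        · exact n2.1.1 h
        · exact n2.1.2 h
      grind)
    have e1 := pairSum_split (adjW G) A u' v' B
    have e2 := pairSum_split (adjW (G ⊔ edge u v)) A u' v' B
    have hle := adjW_le (G ⊔ edge u v) u' v'
    have hlt : pairSum (adjW G) (A ++ u' :: v' :: B) < s := by
      by_contra hc
      exact hG ⟨_, h1, h2, by omega⟩
    have := deg_sum_le_aux G u' v' hn' A B h1 h2 (by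
      rintro ⟨l', b1, b2, b3⟩
      exact hG ⟨l', b1, b2, by omega⟩)
    omega
  by_cases hex : ∃ A B, l = A ++ u :: v :: B
  · obtain ⟨A, B, h⟩ := hex
    exact main u v A B (Or.inl ⟨rfl, rfl⟩) h
  by_cases hex' : ∃ A B, l = A ++ v :: u :: B
  · obtain ⟨A, B, h⟩ := hex'
    have := main v u A B (Or.inr ⟨rfl, rfl⟩) h
    omega
  exfalso
  refine hG ⟨l, h1, h2, h3.trans (hmono l ?_)⟩
  intro A x y B hl
  constructor
  · rintro ⟨rfl, rfl⟩; exact hex ⟨A, B, hl⟩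
  · rintro ⟨rfl, rfl⟩; exact hex' ⟨A, B, hl⟩

theorem pairSum_top {V : Type*} (l : List V) (hl : l.Nodup) :
    l.length ≤ pairSum (adjW (⊤ : SimpleGraph V)) l + 1 := by
  induction l with
  | nil => simp
  | cons a l ih =>
    cases l with
    | nil => simp
    | cons b l =>
      have := ih (List.nodup_cons.1 hl).2
      have hab : a ≠ b := by
        have := (List.nodup_cons.1 hl).1
        simp at this; tauto
      have : adjW (⊤ : SimpleGraph V) a b = 1 := by simp [adjW, hab]
      simp only [pairSum, List.length_cons] at *
      omega

theorem edges_le_split {n : ℕ} (G : SimpleGraph (Fin n)) (k : ℕ) (L : Finset (Fin n))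
    (hL : ∀ x ∈ L, {w | G.Adj x w}.ncard ≤ k) :
    G.edgeSet.ncard ≤ k * L.card + (n - L.card).choose 2 := by
  classical
  have hsub : G.edgeSet ⊆ ((L.biUnion fun x => G.incidenceFinset x) ∪
      (Lᶜ).offDiag.image Sym2.mk.uncurry : Finset (Sym2 (Fin n))) := by
    intro e
    induction e using Sym2.ind with
    | _ x y =>
      intro h
      have h' : G.Adj x y := h
      simp only [Finset.coe_union, Set.mem_union, Finset.mem_coe, Finset.mem_biUnion,
        Finset.mem_image]
      by_cases hx : x ∈ L
      · exact Or.inl ⟨x, hx, by simp [h']⟩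
      by_cases hy : y ∈ L
      · refine Or.inl ⟨y, hy, ?_⟩
        rw [Sym2.eq_swap]; simp [h'.symm]
      · exact Or.inr ⟨(x, y), by simp [hx, hy, h'.ne], rfl⟩
  have h1 := Set.ncard_le_ncard hsub (Finset.finite_toSet _)
  rw [Set.ncard_coe_finset] at h1
  have h2 := Finset.card_union_le (L.biUnion fun x => G.incidenceFinset x)
    ((Lᶜ).offDiag.image Sym2.mk.uncurry)
  rw [Sym2.card_image_offDiag, Finset.card_compl, Fintype.card_fin] at h2
  have h3 : (L.biUnion fun x => G.incidenceFinset x).card ≤ L.card * k := by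
    apply Finset.card_biUnion_le_card_mul
    intro x hx
    rw [card_incidenceFinset_eq_degree]
    have := hL x hx
    rw [Set.ncard_eq_toFinset_card'] at this
    simpa [← card_neighborFinset_eq_degree, neighborFinset_eq_filter] using this
  rw [mul_comm k]
  omega

theorem arith_bound (n s k : ℕ) (hs1 : 1 ≤ s) (hs2 : s ≤ n - 1) (hk : 2 * k + 1 ≤ s) :
    k * (n - s + k) + (n - (n - s + k)).choose 2 ≤ max (s.choose 2)
        (n.choose 2 - (n - (s - 1) / 2).choose 2 + (if Odd s then 0 else 1)) := by
  set t := (s - 1) / 2 with ht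
  obtain ⟨m, rfl⟩ : ∃ m, n = s + 1 + m := ⟨n - (s + 1), by omega⟩
  have hle : (s + 1 + m - t).choose 2 ≤ (s + 1 + m).choose 2 :=
    Nat.choose_le_choose 2 (by omega)
  have cast2 : ∀ a : ℕ, ((a.choose 2 : ℕ) : ℚ) = a * (a - 1) / 2 := fun a => Nat.cast_choose_two ℚ a
  have hkt : k ≤ t := by omega
  have e1 : s + 1 + m - s + k = 1 + m + k := by omega
  have e2 : s + 1 + m - (1 + m + k) = s - k := by omega
  rw [e1, e2, le_max_iff]
  by_contra hcon
  push Not at hcon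
  obtain ⟨c1, c2⟩ := hcon
  have d1 : ((s.choose 2 : ℕ) : ℚ) < ((k * (1 + m + k) + (s - k).choose 2 : ℕ) : ℚ) := by
    exact_mod_cast c1
  have d2 : (((s + 1 + m).choose 2 - (s + 1 + m - t).choose 2 + (if Odd s then 0 else 1) : ℕ) : ℚ)
     < ((k * (1 + m + k) + (s - k).choose 2 : ℕ) : ℚ) := by
    exact_mod_cast c2
  have hsk : k ≤ s := by omega
  have hts : t ≤ s + 1 + m := by omega
  have hkt' : (k : ℚ) ≤ t := by exact_mod_cast hkt
  have hk0 : (0 : ℚ) ≤ k := by positivity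
  have hm0 : (0 : ℚ) ≤ m := by positivity
  have hs0 : (1 : ℚ) ≤ s := by exact_mod_cast hs1
  rw [Nat.cast_add, cast2, cast2, Nat.cast_sub hsk] at d1
  rw [Nat.cast_add, Nat.cast_add, Nat.cast_sub hle, cast2, cast2, cast2, Nat.cast_sub hts,
    Nat.cast_sub hsk] at d2
  push_cast at d1 d2
  -- d1 : f 0 < f k
  have hkpos : (0 : ℚ) < k := by
    rcases hk0.eq_or_lt with h | h
    · rw [← h] at d1; norm_num at d1
    · exact h
  have d1' : (0 : ℚ) < 2 * (1 + m) + 3 * k - 2 * s + 1 := by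
    by_contra hneg
    push Not at hneg
    nlinarith [mul_nonneg hkpos.le (neg_nonneg.2 hneg)]
  rcases Nat.even_or_odd s with he | ho
  · have hno : ¬ Odd s := Nat.not_odd_iff_even.2 he
    have hst : (s : ℚ) = 2 * t + 2 := by
      have : s = 2 * t + 2 := by obtain ⟨r, hr⟩ := he; omega
      exact_mod_cast this
    simp only [hno, if_false] at d2
    rw [hst] at d2 d1'
    nlinarith [mul_nonneg (sub_nonneg.2 hkt') d1'.le, mul_nonneg (sub_nonneg.2 hkt') (sub_nonneg.2 hkt')]
  · have hst : (s : ℚ) = 2 * t + 1 := by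
      have : s = 2 * t + 1 := by obtain ⟨r, hr⟩ := ho; omega
      exact_mod_cast this
    simp only [ho, if_true] at d2
    rw [hst] at d2 d1'
    nlinarith [mul_nonneg (sub_nonneg.2 hkt') d1'.le, mul_nonneg (sub_nonneg.2 hkt') (sub_nonneg.2 hkt')]

theorem upper_bound (n s : ℕ) (hs1 : 1 ≤ s) (hs2 : s ≤ n - 1) (G₀ : SimpleGraph (Fin n))
    (h₀ : ¬ ContainsLinForest G₀ s) : G₀.edgeSet.ncard ≤ max (s.choose 2)
        (n.choose 2 - (n - (s - 1) / 2).choose 2 + (if Odd s then 0 else 1)) := by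
  classical
  have h₀' : ¬ HasOrd G₀ s := fun h => h₀ (contains_of_hasOrd _ _ h)
  obtain ⟨G, hle, hmax⟩ := (Set.toFinite {G : SimpleGraph (Fin n) | ¬ HasOrd G s}).exists_le_maximal h₀'
  have hG : ¬ HasOrd G s := hmax.prop
  refine (Set.ncard_le_ncard (edgeSet_subset_edgeSet.2 hle)).trans ?_
  have hdeg : ∀ u v, u ≠ v → ¬ G.Adj u v →
      {w | G.Adj u w}.ncard + {w | G.Adj v w}.ncard + 1 ≤ s := by
    intro u v huv hn
    refine deg_sum_le G s u v huv hn hG ?_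
    by_contra hc
    have := hmax.le_of_ge (y := G ⊔ edge u v) hc le_sup_left
    exact hn (this (by simp [edge_adj, huv]))
  have hne : ∃ p : Fin n × Fin n, p.1 ≠ p.2 ∧ ¬ G.Adj p.1 p.2 := by
    by_contra hc
    push Not at hc
    have : G = ⊤ := by
      ext a b
      exact ⟨fun h => h.ne, fun h => hc (a, b) h⟩
    subst this
    refine hG ⟨List.finRange n, List.nodup_finRange n, by simp, ?_⟩
    have := pairSum_top (List.finRange n) (List.nodup_finRange n)
    rw [List.length_finRange] at this
    omega
  obtain ⟨⟨u, v⟩, ⟨huv, hn⟩, hmx⟩ := (Set.toFinite {p : Fin n × Fin n | p.1 ≠ p.2 ∧ ¬ G.Adj p.1 p.2}).exists_maximalFor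
    (fun p => {w | G.Adj p.1 w}.ncard + {w | G.Adj p.2 w}.ncard) _ hne
  have hmx' : ∀ x y, x ≠ y → ¬ G.Adj x y → {w | G.Adj x w}.ncard + {w | G.Adj y w}.ncard ≤
      {w | G.Adj u w}.ncard + {w | G.Adj v w}.ncard := by
    intro x y hxy hxy'
    have := @hmx (x, y) ⟨hxy, hxy'⟩
    simp only at this
    omega
  clear hmx
  simp only at huv hn
  wlog huvd : {w | G.Adj u w}.ncard ≤ {w | G.Adj v w}.ncard generalizing u v
  · exact this v u huv.symm (fun h => hn h.symm) (fun x y a b => by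
      rw [add_comm {w | G.Adj v w}.ncard]; exact hmx' x y a b) (by omega)
  set k := {w | G.Adj u w}.ncard with hk
  have hd := hdeg u v huv hn
  -- non-neighbours of v
  let N : Finset (Fin n) := (Finset.univ.filter fun w => G.Adj v w)
  have hN : N.card = {w | G.Adj v w}.ncard := by
    rw [Set.ncard_eq_toFinset_card']; simp [N]
  have hvN : v ∉ N := by simp [N]
  have hcard : (insert v N)ᶜ.card = n - ({w | G.Adj v w}.ncard + 1) := by
    rw [Finset.card_compl, Finset.card_insert_of_notMem hvN, hN, Fintype.card_fin]
  obtain ⟨L, hL1, hL2⟩ := Finset.exists_subset_card_eq (s := (insert v N)ᶜ) (n := n - s + k) (by omega)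
  have := edges_le_split G k L (by
    intro x hx
    have := hL1 hx
    simp only [Finset.mem_compl, Finset.mem_insert, not_or, N, Finset.mem_filter,
      Finset.mem_univ, true_and] at this
    have := hmx' x v this.1 (fun h => this.2 h.symm)
    omega)
  rw [hL2] at this
  exact this.trans (arith_bound n s k hs1 hs2 (by omega))

theorem acyclic_edges {s : ℕ} (hs : 1 ≤ s) (H : SimpleGraph (Fin s)) (hH : H.IsAcyclic) :
    H.edgeSet.ncard + 1 ≤ s := by
  classical
  have : Nonempty (Fin s) := ⟨⟨0, hs⟩⟩
  obtain ⟨T, hT, _, hT2⟩ := (connected_top (V := Fin s)).exists_isTree_le_of_le_of_isAcyclic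
    (le_top : H ≤ ⊤) hH
  have h1 := hT2.card_edgeFinset
  have h2 := Set.ncard_le_ncard (edgeSet_subset_edgeSet.2 ‹H ≤ T›)
  rw [Set.ncard_eq_toFinset_card' T.edgeSet] at h2
  simp only [Fintype.card_fin, edgeFinset] at h1
  omega

theorem lower1 (n s : ℕ) (hs1 : 1 ≤ s) (hs2 : s ≤ n - 1) :
    ∃ G : SimpleGraph (Fin n), ¬ ContainsLinForest G s ∧ G.edgeSet.ncard = s.choose 2 := by
  classical
  let S : Finset (Fin n) := Finset.univ.filter fun x => x.1 < s
  have hS : S.card = s := by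
    have : S = Finset.univ.map (Fin.castLEEmb (show s ≤ n by omega)) := by
      ext x
      simp only [S, Finset.mem_filter, Finset.mem_univ, true_and, Finset.mem_map]
      constructor
      · intro h; exact ⟨⟨x.1, h⟩, rfl⟩
      · rintro ⟨y, rfl⟩; exact y.2
    rw [this]; simp
  refine ⟨fromEdgeSet (S.offDiag.image Sym2.mk.uncurry : Finset (Sym2 (Fin n))), ?_, ?_⟩
  · rintro ⟨H, h1, h2, h3⟩
    let f : Fin s ↪ Fin n := Fin.castLEEmb (show s ≤ n by omega)
    have hac := acyclic_edges hs1 (H.comap f) (h2.1.of_comap f)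
    have hsub : H.edgeSet ⊆ Set.image (Sym2.map f) (H.comap f).edgeSet := by
      intro e
      induction e using Sym2.ind with
      | _ x y =>
        intro h
        have h' : H.Adj x y := h
        have := h1 h'
        simp only [fromEdgeSet_adj, Finset.mem_coe, Finset.mem_image, Prod.exists] at this
        obtain ⟨⟨a, b, hab, he⟩, _⟩ := this
        simp only [S, Finset.mem_offDiag, Finset.mem_filter, Finset.mem_univ, true_and] at hab
        simp only [Function.uncurry, Sym2.eq_iff] at he
        have hx : x.1 < s ∧ y.1 < s := by
          rcases he with ⟨rfl, rfl⟩ | ⟨rfl, rfl⟩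
          · exact ⟨hab.1, hab.2.1⟩
          · exact ⟨hab.2.1, hab.1⟩
        exact ⟨s(⟨x.1, hx.1⟩, ⟨y.1, hx.2⟩), h', rfl⟩
    have := Set.ncard_le_ncard hsub
    have := Set.ncard_image_le (f := Sym2.map f) (Set.toFinite (H.comap f).edgeSet)
    omega
  · rw [edgeSet_fromEdgeSet, sdiff_eq_left.2, Set.ncard_coe_finset, Sym2.card_image_offDiag, hS]
    rw [Set.disjoint_left]
    intro e he
    simp only [Finset.mem_coe, Finset.mem_image, Prod.exists] at he
    obtain ⟨a, b, hab, rfl⟩ := he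
    simp at hab
    simpa [Function.uncurry] using hab.2.2

theorem lower2 (n s : ℕ) (hs1 : 1 ≤ s) (hs2 : s ≤ n - 1) :
    ∃ G : SimpleGraph (Fin n), ¬ ContainsLinForest G s ∧ G.edgeSet.ncard =
      n.choose 2 - (n - (s - 1) / 2).choose 2 + (if Odd s then 0 else 1) := by
  classical
  set t := (s - 1) / 2 with ht
  let T : Finset (Fin n) := Finset.univ.filter fun x => x.1 < t
  have hT : T.card = t := by
    have : T = Finset.univ.map (Fin.castLEEmb (show t ≤ n by omega)) := by
      ext x
      simp only [T, Finset.mem_filter, Finset.mem_univ, true_and, Finset.mem_map]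
      constructor
      · intro h; exact ⟨⟨x.1, h⟩, rfl⟩
      · rintro ⟨y, rfl⟩; exact y.2
    rw [this]; simp
  let a : Fin n := ⟨t, by omega⟩
  let b : Fin n := ⟨t + 1, by omega⟩
  have hab : a ≠ b := by simp [a, b]
  let A : Finset (Sym2 (Fin n)) := Finset.univ.offDiag.image Sym2.mk.uncurry
  let B : Finset (Sym2 (Fin n)) := Tᶜ.offDiag.image Sym2.mk.uncurry
  let X : Finset (Sym2 (Fin n)) := if Odd s then ∅ else {s(a, b)}
  have hXc : X.card = if Odd s then 0 else 1 := by
    simp only [X]; split_ifs <;> simp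
  have hXB : X ⊆ B := by
    simp only [X]; split_ifs
    · simp
    · rw [Finset.singleton_subset_iff]
      simp only [B, Finset.mem_image]
      exact ⟨(a, b), by simp [T, a, b], rfl⟩
  have hBA : B ⊆ A := Finset.image_subset_image (Finset.offDiag_mono (Finset.subset_univ _))
  have hdis : Disjoint (A \ B) X :=
    Finset.disjoint_of_subset_right hXB Finset.sdiff_disjoint
  have hcard : ((A \ B) ∪ X).card = n.choose 2 - (n - t).choose 2 + (if Odd s then 0 else 1) := by
    rw [Finset.card_union_of_disjoint hdis, Finset.card_sdiff_of_subset hBA, hXc,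
      Sym2.card_image_offDiag, Sym2.card_image_offDiag, Finset.card_compl, hT]
    simp
  refine ⟨fromEdgeSet ((A \ B) ∪ X : Finset (Sym2 (Fin n))), ?_, ?_⟩
  · rintro ⟨H, h1, h2, h3⟩
    have hsub : H.edgeSet ⊆ ((T.biUnion fun x => H.incidenceFinset x) ∪ X : Finset _) := by
      intro e
      induction e using Sym2.ind with
      | _ x y =>
        intro h
        have h' : H.Adj x y := h
        have := h1 h'
        rw [fromEdgeSet_adj, Finset.mem_coe, Finset.mem_union, Finset.mem_sdiff] at this
        rw [Finset.mem_coe, Finset.mem_union, Finset.mem_biUnion]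
        rcases this.1 with ⟨_, hB⟩ | hX
        · left
          by_cases hx : x ∈ T
          · exact ⟨x, hx, by simp [h']⟩
          by_cases hy : y ∈ T
          · refine ⟨y, hy, ?_⟩
            rw [Sym2.eq_swap]; simp [h'.symm]
          · exfalso
            apply hB
            simp only [B, Finset.mem_image]
            exact ⟨(x, y), by simp [hx, hy, h'.ne], rfl⟩
        · exact Or.inr hX
    have c1 := Set.ncard_le_ncard hsub (Finset.finite_toSet _)
    rw [Set.ncard_coe_finset, h3] at c1
    have c2 := Finset.card_union_le (T.biUnion fun x => H.incidenceFinset x) X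
    have c3 : (T.biUnion fun x => H.incidenceFinset x).card ≤ T.card * 2 := by
      apply Finset.card_biUnion_le_card_mul
      intro x hx
      rw [card_incidenceFinset_eq_degree]
      have := h2.2 x
      rw [Set.ncard_eq_toFinset_card'] at this
      simpa [← card_neighborFinset_eq_degree, neighborFinset_eq_filter] using this
    rw [hT] at c3
    rcases Nat.even_or_odd s with he | ho
    · have hno : ¬ Odd s := Nat.not_odd_iff_even.2 he
      rw [if_neg hno] at hXc
      obtain ⟨r, hr⟩ := he
      omega
    · rw [if_pos ho] at hXc
      omega
  · rw [edgeSet_fromEdgeSet, sdiff_eq_left.2, Set.ncard_coe_finset, hcard]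
    rw [Set.disjoint_left]
    intro e he
    have he : e ∈ A := by
      rw [Finset.mem_coe, Finset.mem_union, Finset.mem_sdiff] at he
      rcases he with he | he
      · exact he.1
      · exact hBA (hXB he)
    simp only [A, Finset.mem_image, Prod.exists] at he
    obtain ⟨a, b, hab, rfl⟩ := he
    simp at hab
    simpa [Function.uncurry] using hab

/-- Ning–Wang: for `1 ≤ s ≤ n - 1`, the maximum number of edges of an `𝓛_s`-free graph on
`n` vertices is `max { C(s,2), C(n,2) - C(n - ⌊(s-1)/2⌋, 2) + c }`, where `c = 0` if `s` is
odd and `c = 1` if `s` is even. -/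
theorem turan_number_linear_forest (n s : ℕ) (hs1 : 1 ≤ s) (hs2 : s ≤ n - 1) :
    IsGreatest {m : ℕ | ∃ G : SimpleGraph (Fin n), ¬ ContainsLinForest G s ∧
        G.edgeSet.ncard = m}
      (max (s.choose 2)
        (n.choose 2 - (n - (s - 1) / 2).choose 2 + (if Odd s then 0 else 1))) := by
  constructor
  · rcases max_choice (s.choose 2)
        (n.choose 2 - (n - (s - 1) / 2).choose 2 + (if Odd s then 0 else 1)) with h | h
    · rw [h]; exact lower1 n s hs1 hs2
    · rw [h]; exact lower2 n s hs1 hs2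
  · rintro m ⟨G, hG, rfl⟩
    exact upper_bound n s hs1 hs2 G hG
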